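/- arXiv:2511.22358 — 3 statements merged into one kernel-verified Lean document; each statement's English description precedes it below -/
import Mathlib

section
/- There is a constant C such that for every integer n ≥ 1 there exists a simple graph G on exactly n vertices with at most (14/5)·n·log₂ n + C·n edges that contains every tree on n vertices. -/
/-- `G` contains `H`: there is an injective map from the vertices of `H` to those of `G`
sending adjacent vertices to adjacent vertices. -/
def Contains {α β : Type*} (G : SimpleGraph β) (H : SimpleGraph α) : Prop :=
  ∃ f : α → β, Function.Injective f ∧ ∀ u v : α, H.Adj u v → G.Adj (f u) (f v)

/-- In a forest, every vertex set `W` whose part `S` is joined to the rest of `W` only through `x`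
can be cut at some vertex `y` so that the part cut off has between `α` and `2 * α` vertices. -/
lemma exists_separator_of_closed {V : Type*} [DecidableEq V] {T : SimpleGraph V}
    (hT : T.IsAcyclic) (W : Finset V) (α : ℕ) (x : V) (S : Finset V) (hxW : x ∈ W) (hSW : S ⊆ W)
    (hxS : x ∉ S) (hS : ∀ a ∈ S, ∀ b ∈ W, b ∉ S → b ≠ x → ¬ T.Adj a b) (hα : α ≤ S.card) :
    ∃ y ∈ W, ∃ R ⊆ W, y ∉ R ∧ (∀ a ∈ R, ∀ b ∈ W, b ∉ R → b ≠ y → ¬ T.Adj a b) ∧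
      α ≤ R.card ∧ R.card ≤ 2 * α := by
  classical
  induction hm : S.card using Nat.strong_induction_on generalizing x S with
  | _ m ih =>
  subst hm
  by_cases hle : S.card ≤ 2 * α
  · exact ⟨x, hxW, S, hSW, hxS, hS, hα, hle⟩
  have move : ∀ y ∈ S, (∀ z ∈ S, T.Adj x z → z = y) →
      ∃ y ∈ W, ∃ R ⊆ W, y ∉ R ∧ (∀ a ∈ R, ∀ b ∈ W, b ∉ R → b ≠ y → ¬ T.Adj a b) ∧
        α ≤ R.card ∧ R.card ≤ 2 * α := by
    intro y hy huniq
    have hc := Finset.card_erase_of_mem hy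
    refine ih (S.erase y).card (by omega) y (S.erase y) (hSW hy)
      ((Finset.erase_subset _ _).trans hSW) (by simp) ?_ (by omega) rfl
    intro a ha b hb hbS hby hab
    rw [Finset.mem_erase] at ha hbS
    have hbS' : b ∉ S := fun h => hbS ⟨hby, h⟩
    by_cases hbx : b = x
    · subst hbx
      exact ha.1 (huniq a ha.2 hab.symm)
    · exact hS a ha.2 b hb hbS' hbx hab
  by_cases hN : ∃ y ∈ S, T.Adj x y
  · obtain ⟨y, hy, hxy⟩ := hN
    have hbr := SimpleGraph.isAcyclic_iff_forall_adj_isBridge.1 hT hxy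
    have hnr : ¬ (T.deleteEdges {s(x, y)}).Reachable x y := by
      rw [SimpleGraph.isBridge_iff] at hbr
      exact hbr
    set C := S.filter fun w => (T.deleteEdges {s(x, y)}).Reachable y w with hC
    have hCS : C ⊆ S := Finset.filter_subset _ _
    have hyC : y ∈ C := by simp [hC, hy]
    have hCcl : ∀ a ∈ C, ∀ b ∈ W, b ∉ C → b ≠ x → ¬ T.Adj a b := by
      intro a ha b hb hbC hbx hab
      have hbS : b ∈ S := by
        by_contra h
        exact hS a (hCS ha) b hb h hbx hab
      refine hbC (Finset.mem_filter.2 ⟨hbS, (Finset.mem_filter.1 ha).2.trans ?_⟩)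
      refine SimpleGraph.Adj.reachable ?_
      rw [SimpleGraph.deleteEdges_adj]
      refine ⟨hab, ?_⟩
      have hax : a ≠ x := fun h => hxS (h ▸ hCS ha)
      simp only [Set.mem_singleton_iff, Sym2.eq_iff]
      rintro (h | h)
      · exact hax h.1
      · exact hbx h.2
    by_cases hCeq : C = S
    · refine move y hy fun z hz hxz => ?_
      by_contra hzy
      rw [← hCeq] at hz
      refine hnr ((SimpleGraph.Adj.reachable ?_).trans (Finset.mem_filter.1 hz).2.symm)
      rw [SimpleGraph.deleteEdges_adj]
      refine ⟨hxz, ?_⟩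
      simp only [Set.mem_singleton_iff, Sym2.eq_iff]
      rintro (h | h)
      · exact hzy h.2
      · exact hxy.ne h.1
    · have hlt : C.card < S.card := Finset.card_lt_card (hCS.ssubset_of_ne hCeq)
      have hpos : 0 < C.card := Finset.card_pos.2 ⟨y, hyC⟩
      have hsd := Finset.card_sdiff_of_subset hCS
      by_cases hCα : α ≤ C.card
      · exact ih C.card hlt x C hxW (hCS.trans hSW) (fun h => hxS (hCS h)) hCcl hCα rfl
      · refine ih (S \ C).card (by omega) x (S \ C) hxW (Finset.sdiff_subset.trans hSW)
          (fun h => hxS (Finset.sdiff_subset h)) ?_ (by omega) rfl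
        intro a ha b hb hbS hbx hab
        rw [Finset.mem_sdiff] at ha hbS
        by_cases hbS' : b ∈ S
        · have hbC : b ∈ C := by
            by_contra h
            exact hbS ⟨hbS', h⟩
          exact hCcl b hbC a (hSW ha.1) ha.2 (fun h => hxS (h ▸ ha.1)) hab.symm
        · exact hS a ha.1 b hb hbS' hbx hab
  · have hne : S.Nonempty := Finset.card_pos.1 (by omega)
    obtain ⟨y, hy⟩ := hne
    exact move y hy fun z hz hxz => absurd ⟨z, hz, hxz⟩ hN

/-- A forest on `W` with more than `α` vertices splits at some vertex `y` into two parts without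
edges between them, the first having between `α` and `2 * α` vertices. -/
lemma exists_separator {V : Type*} [DecidableEq V] {T : SimpleGraph V}
    (hT : T.IsAcyclic) (W : Finset V) (α : ℕ) (hα : α < W.card) :
    ∃ y ∈ W, ∃ R ⊆ W, y ∉ R ∧ (∀ a ∈ R, ∀ b ∈ W, b ∉ R → b ≠ y → ¬ T.Adj a b) ∧
      α ≤ R.card ∧ R.card ≤ 2 * α := by
  obtain ⟨x, hx⟩ : W.Nonempty := Finset.card_pos.1 (by omega)
  have hc := Finset.card_erase_of_mem hx
  refine exists_separator_of_closed hT W α x (W.erase x) hx (Finset.erase_subset _ _) (by simp) ?_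
    (by omega)
  intro a _ b hb hbW hbx
  exact absurd (Finset.mem_erase.2 ⟨hbx, hb⟩) hbW

/-- An odd multiple `a` of `2 ^ i` reaches the integers less than `3 * 2 ^ i` below it and less
than `2 * 2 ^ i` above it. -/
def Reaches (a b : ℤ) : Prop :=
  ∃ i : ℕ, ∃ j : ℤ, a = 2 ^ i * (2 * j + 1) ∧ a < b + 3 * 2 ^ i ∧ b < a + 2 * 2 ^ i

/-- The part of `T` on `W` can be placed injectively in `I` so that, of the places of any two
adjacent vertices, one reaches the other. -/
def EmbedsIn {V : Type*} (T : SimpleGraph V) (W : Finset V) (I : Set ℤ) : Prop :=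
  ∃ f : V → ℤ, Set.InjOn f W ∧ Set.MapsTo f W I ∧
    ∀ a ∈ W, ∀ b ∈ W, T.Adj a b → Reaches (f a) (f b) ∨ Reaches (f b) (f a)

lemma EmbedsIn.glue {V : Type*} [DecidableEq V] {T : SimpleGraph V} {W R : Finset V} {x : V}
    {q : ℤ} {I J K : Set ℤ} (hxR : x ∉ R)
    (hsep : ∀ a ∈ R, ∀ b ∈ W, b ∉ R → b ≠ x → ¬ T.Adj a b)
    (hR : EmbedsIn T R I) (hR' : EmbedsIn T ((W \ R).erase x) J)
    (hIK : I ⊆ K) (hJK : J ⊆ K) (hq : q ∈ K) (hIJ : Disjoint I J) (hqI : q ∉ I) (hqJ : q ∉ J)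
    (hreach : ∀ y ∈ K, Reaches q y) : EmbedsIn T W K := by
  obtain ⟨f, hf, hfI, hfa⟩ := hR
  obtain ⟨g, hg, hgJ, hga⟩ := hR'
  set h : V → ℤ := fun w => if w = x then q else if w ∈ R then f w else g w with hh
  have hx : h x = q := by simp [hh]
  have hr : ∀ w ∈ R, h w = f w := fun w hw => by
    have : w ≠ x := fun e => hxR (e ▸ hw)
    simp [hh, this, hw]
  have hr' : ∀ w ∈ (W \ R).erase x, h w = g w := fun w hw => by
    simp only [Finset.mem_erase, Finset.mem_sdiff] at hw
    simp [hh, hw.1, hw.2.2]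
  have key : ∀ w ∈ W, w = x ∨ w ∈ R ∨ w ∈ (W \ R).erase x := fun w hw => by
    simp only [Finset.mem_erase, Finset.mem_sdiff]
    tauto
  have hmaps : Set.MapsTo h W K := by
    intro w hw
    rcases key w hw with rfl | hw | hw
    · rwa [hx]
    · rw [hr w hw]; exact hIK (hfI hw)
    · rw [hr' w hw]; exact hJK (hgJ hw)
  refine ⟨h, ?_, hmaps, ?_⟩
  · intro a ha b hb hab
    rcases key a ha with rfl | ha | ha <;> rcases key b hb with rfl | hb | hb
    · rfl
    · rw [hx, hr b hb] at hab
      exact absurd (hfI hb) (hab ▸ hqI)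
    · rw [hx, hr' b hb] at hab
      exact absurd (hgJ hb) (hab ▸ hqJ)
    · rw [hx, hr a ha] at hab
      exact absurd (hfI ha) (hab ▸ hqI)
    · rw [hr a ha, hr b hb] at hab
      exact hf ha hb hab
    · rw [hr a ha, hr' b hb] at hab
      exact absurd (hgJ hb) (hab ▸ Set.disjoint_left.1 hIJ (hfI ha))
    · rw [hx, hr' a ha] at hab
      exact absurd (hgJ ha) (hab ▸ hqJ)
    · rw [hr' a ha, hr b hb] at hab
      exact absurd (hgJ ha) (hab ▸ Set.disjoint_left.1 hIJ (hfI hb))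
    · rw [hr' a ha, hr' b hb] at hab
      exact hg ha hb hab
  · intro a ha b hb hab
    by_cases hax : a = x
    · subst hax
      rw [hx]
      exact Or.inl (hreach _ (hmaps hb))
    by_cases hbx : b = x
    · subst hbx
      rw [hx]
      exact Or.inr (hreach _ (hmaps ha))
    by_cases haR : a ∈ R <;> by_cases hbR : b ∈ R
    · rw [hr a haR, hr b hbR]
      exact hfa a haR b hbR hab
    · exact absurd hab (hsep a haR b hb hbR hbx)
    · exact absurd hab.symm (hsep b hbR a ha haR hax)
    · have ha' : a ∈ (W \ R).erase x := by simp [hax, ha, haR]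
      have hb' : b ∈ (W \ R).erase x := by simp [hbx, hb, hbR]
      rw [hr' a ha', hr' b hb']
      exact hga a ha' b hb' hab

/-- A forest on `u + v` vertices fits into an interval around a multiple `p` of `2 ^ k`, with `u`
places to the left of `p` and `v` places to its right. -/
lemma embedsIn_punctured_Icc {V : Type*} [DecidableEq V] {T : SimpleGraph V} (hT : T.IsAcyclic)
    (W : Finset V) (p : ℤ) (k u v : ℕ) (hp : (2 : ℤ) ^ k ∣ p) (hu : u < 2 ^ k) (hv : v < 2 ^ k)
    (hW : W.card = u + v) : EmbedsIn T W (Set.Icc (p - u) (p + v) \ {p}) := by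
  induction hm : W.card using Nat.strong_induction_on generalizing W p k u v with
  | _ m ih =>
  subst hm
  by_cases h0 : W.card = 0
  · rw [Finset.card_eq_zero] at h0
    subst h0
    exact ⟨fun _ => 0, by simp, fun w hw => by simp at hw, by simp⟩
  set i := Nat.log 2 (max u v) with hi
  have hmax : max u v ≠ 0 := by omega
  have hlo : 2 ^ i ≤ max u v := Nat.pow_log_le_self 2 hmax
  have hhi : max u v < 2 ^ (i + 1) := Nat.lt_pow_succ_log_self (by norm_num) _
  have hik : i < k := by
    have : 2 ^ i < 2 ^ k := by omega
    exact (Nat.pow_lt_pow_iff_right (by norm_num)).1 this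
  obtain ⟨c, hc⟩ : (2 : ℤ) ^ (i + 1) ∣ p := (pow_dvd_pow 2 hik).trans hp
  have hpi : (2 : ℤ) ^ i ∣ p := (pow_dvd_pow 2 hik.le).trans hp
  rw [pow_succ] at hhi hc
  have hcast : ((2 ^ i : ℕ) : ℤ) = 2 ^ i := by push_cast; rfl
  obtain ⟨N, hN⟩ : ∃ N : ℕ, N = 2 ^ i := ⟨_, rfl⟩
  have hNk : N < 2 ^ k := by rw [hN]; exact Nat.pow_lt_pow_right (by norm_num) hik
  have hNpos : 0 < N := by rw [hN]; positivity
  rw [← hN] at hlo hhi hcast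
  by_cases hcase : N ≤ v
  · obtain ⟨x, hxW, R, hRW, hxR, hsep, hR1, hR2⟩ := exists_separator hT W (v - N) (by omega)
    have hsd := Finset.card_sdiff_of_subset hRW
    have hse := Finset.card_erase_of_mem (Finset.mem_sdiff.2 ⟨hxW, hxR⟩)
    have hRlt : R.card < W.card := Finset.card_lt_card
      (hRW.ssubset_of_ne fun h => hxR (h ▸ hxW))
    have e1 := ih R.card hRlt R (p + N) i (R.card - (v - N)) (v - N)
      (by rw [hcast]; exact dvd_add hpi dvd_rfl) (by omega) (by omega) (by omega) rfl
    have e2 := ih ((W \ R).erase x).card (by omega) ((W \ R).erase x) p k u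
      (v - 1 - R.card) hp hu (by omega) (by omega) rfl
    refine EmbedsIn.glue (q := p + N) hxR hsep e1 e2 ?_ ?_ ?_ ?_ ?_ ?_ ?_
    · intro y hy
      simp only [Set.mem_sdiff, Set.mem_Icc, Set.mem_singleton_iff] at hy ⊢
      omega
    · intro y hy
      simp only [Set.mem_sdiff, Set.mem_Icc, Set.mem_singleton_iff] at hy ⊢
      omega
    · simp only [Set.mem_sdiff, Set.mem_Icc, Set.mem_singleton_iff]
      omega
    · rw [Set.disjoint_left]
      intro y hy hy'
      simp only [Set.mem_sdiff, Set.mem_Icc, Set.mem_singleton_iff] at hy hy'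
      omega
    · simp
    · simp only [Set.mem_sdiff, Set.mem_Icc, Set.mem_singleton_iff]
      omega
    · intro y hy
      simp only [Set.mem_sdiff, Set.mem_Icc, Set.mem_singleton_iff] at hy
      refine ⟨i, c, ?_, ?_, ?_⟩
      · rw [hcast, hc]; ring
      · rw [← hcast]; omega
      · rw [← hcast]; omega
  · obtain ⟨x, hxW, R, hRW, hxR, hsep, hR1, hR2⟩ := exists_separator hT W (u - N) (by omega)
    have hsd := Finset.card_sdiff_of_subset hRW
    have hse := Finset.card_erase_of_mem (Finset.mem_sdiff.2 ⟨hxW, hxR⟩)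
    have hRlt : R.card < W.card := Finset.card_lt_card
      (hRW.ssubset_of_ne fun h => hxR (h ▸ hxW))
    have e1 := ih R.card hRlt R (p - N) i (u - N) (R.card - (u - N))
      (by rw [hcast]; exact dvd_sub hpi dvd_rfl) (by omega) (by omega) (by omega) rfl
    have e2 := ih ((W \ R).erase x).card (by omega) ((W \ R).erase x) p k
      (u - 1 - R.card) v hp (by omega) hv (by omega) rfl
    refine EmbedsIn.glue (q := p - N) hxR hsep e1 e2 ?_ ?_ ?_ ?_ ?_ ?_ ?_
    · intro y hy
      simp only [Set.mem_sdiff, Set.mem_Icc, Set.mem_singleton_iff] at hy ⊢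
      omega
    · intro y hy
      simp only [Set.mem_sdiff, Set.mem_Icc, Set.mem_singleton_iff] at hy ⊢
      omega
    · simp only [Set.mem_sdiff, Set.mem_Icc, Set.mem_singleton_iff]
      omega
    · rw [Set.disjoint_left]
      intro y hy hy'
      simp only [Set.mem_sdiff, Set.mem_Icc, Set.mem_singleton_iff] at hy hy'
      omega
    · simp
    · simp only [Set.mem_sdiff, Set.mem_Icc, Set.mem_singleton_iff]
      omega
    · intro y hy
      simp only [Set.mem_sdiff, Set.mem_Icc, Set.mem_singleton_iff] at hy
      refine ⟨i, c - 1, ?_, ?_, ?_⟩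
      · rw [hcast, hc]; ring
      · rw [← hcast]; omega
      · rw [← hcast]; omega

/-- The graph on the integers `1, …, n` in which two integers are adjacent when one of them
reaches the other. -/
def rulerGraph (n : ℕ) : SimpleGraph (Fin n) :=
  SimpleGraph.fromRel fun a b => Reaches ((a : ℤ) + 1) ((b : ℤ) + 1)

lemma contains_rulerGraph {n : ℕ} {T : SimpleGraph (Fin n)} (hT : T.IsAcyclic) :
    Contains (rulerGraph n) T := by
  obtain ⟨f, hf, hmaps, hadj⟩ := embedsIn_punctured_Icc hT Finset.univ 0 n 0 n (dvd_zero _)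
    (by positivity) Nat.lt_two_pow_self (by simp)
  have hb : ∀ w, 1 ≤ f w ∧ f w ≤ n := fun w => by
    have := hmaps (Finset.mem_coe.2 (Finset.mem_univ w))
    simp only [Set.mem_sdiff, Set.mem_Icc, Set.mem_singleton_iff] at this
    omega
  have hlt : ∀ w, (f w - 1).toNat < n := fun w => by
    have := hb w
    omega
  have hval : ∀ w, (((⟨(f w - 1).toNat, hlt w⟩ : Fin n) : ℕ) : ℤ) + 1 = f w := fun w => by
    have := hb w
    simp only
    omega
  have hinj : Function.Injective fun w => (⟨(f w - 1).toNat, hlt w⟩ : Fin n) := by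
    intro a b hab
    refine hf (by simp) (by simp) ?_
    rw [← hval a, ← hval b]
    simp only at hab
    rw [hab]
  refine ⟨_, hinj, fun u v huv => ?_⟩
  rw [rulerGraph, SimpleGraph.fromRel_adj]
  refine ⟨hinj.ne huv.ne, ?_⟩
  rw [hval, hval]
  exact hadj u (Finset.mem_univ _) v (Finset.mem_univ _) huv

lemma two_mul_ncard_edgeSet_rulerGraph_le {n : ℕ} (hn : 1 ≤ n) :
    2 * (rulerGraph n).edgeSet.ncard ≤ 5 * ((Nat.log 2 n + 3) * n) := by
  classical
  set L := Nat.log 2 n with hL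
  let φ : Fin n → ℤ := fun a => (a : ℤ) + 1
  have hφ : Function.Injective φ := fun a b h => by
    simp only [φ] at h
    exact Fin.ext (by omega)
  let E : Finset (Sym2 ℤ) := (Finset.range (L + 1)).biUnion fun i =>
    (Finset.range ((n / 2 ^ i + 1) / 2) ×ˢ Finset.range (5 * 2 ^ i)).image fun jd =>
      s((2 : ℤ) ^ i * (2 * jd.1 + 1), (2 : ℤ) ^ i * (2 * jd.1 + 1) - 3 * 2 ^ i + jd.2)
  have hmem : ∀ a b : Fin n, Reaches (φ a) (φ b) → s(φ a, φ b) ∈ E := by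
    rintro a b ⟨i, j, hj, h1, h2⟩
    have hpos : (0 : ℤ) < 2 ^ i := by positivity
    have ha1 : 1 ≤ φ a := by simp only [φ]; omega
    have han : φ a ≤ n := by simp only [φ]; omega
    have hj0 : 0 ≤ j := by
      have : 0 < 2 * j + 1 := by
        by_contra h
        push Not at h
        nlinarith
      omega
    obtain ⟨j, rfl⟩ := Int.eq_ofNat_of_zero_le hj0
    have hjn : 2 ^ i * (2 * j + 1) ≤ n := by
      rw [hj] at han
      exact_mod_cast han
    have hin : 2 ^ i ≤ n := le_trans (Nat.le_mul_of_pos_right _ (by omega)) hjn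
    simp only [E, Finset.mem_biUnion, Finset.mem_range, Finset.mem_image, Finset.mem_product,
      Prod.exists]
    refine ⟨i, Nat.lt_succ_of_le (Nat.le_log_of_pow_le (by norm_num) hin), j,
      (φ b - φ a + 3 * 2 ^ i).toNat, ⟨?_, ?_⟩, ?_⟩
    · have : 2 * j + 1 ≤ n / 2 ^ i := by
        rw [Nat.le_div_iff_mul_le (by positivity), mul_comm]
        exact hjn
      omega
    · zify
      rw [Int.toNat_of_nonneg (by linarith)]
      linarith
    · rw [Int.toNat_of_nonneg (by linarith), ← hj]
      rw [show φ a - 3 * 2 ^ i + (φ b - φ a + 3 * 2 ^ i) = φ b by ring]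
  have hsub : Sym2.map φ '' (rulerGraph n).edgeSet ⊆ E := by
    rintro _ ⟨e, he, rfl⟩
    induction e with
    | _ a b =>
    rw [SimpleGraph.mem_edgeSet, rulerGraph, SimpleGraph.fromRel_adj] at he
    rw [Sym2.map_mk]
    rcases he.2 with h | h
    · exact hmem a b h
    · rw [Sym2.eq_swap]
      exact hmem b a h
  have hcard : (rulerGraph n).edgeSet.ncard ≤ E.card := by
    rw [← Set.ncard_image_of_injective _ (Sym2.map.injective hφ), ← Set.ncard_coe_finset]
    exact Set.ncard_le_ncard hsub E.finite_toSet
  have hE : E.card ≤ ∑ i ∈ Finset.range (L + 1), (n / 2 ^ i + 1) / 2 * (5 * 2 ^ i) := by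
    refine Finset.card_biUnion_le.trans (Finset.sum_le_sum fun i _ => ?_)
    exact Finset.card_image_le.trans (by simp)
  have hterm : ∀ i, 2 * ((n / 2 ^ i + 1) / 2 * (5 * 2 ^ i)) ≤ 5 * (n + 2 ^ i) := fun i => by
    have h1 : n / 2 ^ i * 2 ^ i ≤ n := Nat.div_mul_le_self _ _
    have h2 : 2 * ((n / 2 ^ i + 1) / 2) ≤ n / 2 ^ i + 1 := by omega
    nlinarith [Nat.mul_le_mul_right (2 ^ i) h2]
  have hpow : 2 ^ L ≤ n := Nat.pow_log_le_self 2 (by omega)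
  have hgeom : ∑ i ∈ Finset.range (L + 1), 2 ^ i ≤ 2 * n := by
    have := Nat.geomSum_lt (m := 2) le_rfl (s := Finset.range (L + 1)) (n := L + 1)
      fun k hk => Finset.mem_range.1 hk
    rw [pow_succ] at this
    omega
  calc 2 * (rulerGraph n).edgeSet.ncard
      ≤ 2 * ∑ i ∈ Finset.range (L + 1), (n / 2 ^ i + 1) / 2 * (5 * 2 ^ i) := by omega
    _ ≤ ∑ i ∈ Finset.range (L + 1), 5 * (n + 2 ^ i) := by
        rw [Finset.mul_sum]
        exact Finset.sum_le_sum fun i _ => hterm i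
    _ = 5 * ((L + 1) * n + ∑ i ∈ Finset.range (L + 1), 2 ^ i) := by
        rw [← Finset.mul_sum, Finset.sum_add_distrib]
        simp
    _ ≤ 5 * ((L + 3) * n) := by nlinarith

/-- There is a constant `C` such that for every `n ≥ 1` there is an `n`-vertex graph with at
most `(14/5)·n·log₂ n + C·n` edges containing every tree on `n` vertices. -/
theorem statement0 :
    ∃ C : ℝ, ∀ n : ℕ, 1 ≤ n →
      ∃ G : SimpleGraph (Fin n),
        (G.edgeSet.ncard : ℝ) ≤ (14 / 5) * n * Real.logb 2 n + C * n ∧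
        ∀ T : SimpleGraph (Fin n), T.IsTree → Contains G T := by
  refine ⟨15 / 2, fun n hn => ⟨rulerGraph n, ?_, fun T hT => contains_rulerGraph hT.isAcyclic⟩⟩
  have h : (2 : ℝ) * (rulerGraph n).edgeSet.ncard ≤ 5 * ((Nat.log 2 n + 3) * n) := by
    exact_mod_cast two_mul_ncard_edgeSet_rulerGraph_le hn
  have hlog : (Nat.log 2 n : ℝ) ≤ Real.logb 2 n := by
    exact_mod_cast Real.natLog_le_logb n 2
  have hn0 : (0 : ℝ) ≤ n := Nat.cast_nonneg n
  have hL : (0 : ℝ) ≤ Nat.log 2 n := Nat.cast_nonneg _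
  nlinarith [mul_le_mul_of_nonneg_left hlog hn0, mul_nonneg hn0 (hL.trans hlog)]
end

section
/- There is a constant C such that for all integers n ≥ 2 and k ≥ 1 there exists a simple graph G with at most C·k·n·log₂ n edges that contains every graph on n vertices of treewidth at most k. -/
/-- `G` has a tree-decomposition of width at most `k`: bags `B x` indexed by the vertices of a
tree `S`, such that for every vertex `u` of `G` the set of indices whose bag contains `u`
induces a nonempty connected subgraph of `S`, every edge of `G` lies in some bag, and every bag
has at most `k + 1` vertices. -/
def HasTreeDecompWidthLe {V : Type*} (G : SimpleGraph V) (k : ℕ) : Prop :=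
  ∃ (ι : Type) (S : SimpleGraph ι) (B : ι → Set V),
    S.IsTree ∧
    (∀ u : V, (S.induce {x | u ∈ B x}).Connected) ∧
    (∀ u v : V, G.Adj u v → ∃ x, u ∈ B x ∧ v ∈ B x) ∧
    (∀ x, (B x).ncard ≤ k + 1)

open Finset SimpleGraph

section Separator

variable {ι : Type*} {S : SimpleGraph ι} {T : Set ι} {x y z : ι}

/-- The distance in `S` from the vertex `x` to the set `T`. -/
noncomputable def setDist (S : SimpleGraph ι) (x : ι) (T : Set ι) : ℕ :=
  sInf (S.dist x '' T)

theorem setDist_le_dist (hz : z ∈ T) : setDist S x T ≤ S.dist x z :=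
  Nat.sInf_le ⟨z, hz, rfl⟩

theorem exists_dist_eq_setDist (S : SimpleGraph ι) (x : ι) (hT : T.Nonempty) :
    ∃ z ∈ T, S.dist x z = setDist S x T :=
  Nat.sInf_mem (hT.image (S.dist x))

theorem setDist_le_add_one (hS : S.Connected) (hT : T.Nonempty) (hxy : S.Adj x y) :
    setDist S y T ≤ setDist S x T + 1 := by
  obtain ⟨z, hz, h⟩ := exists_dist_eq_setDist S x hT
  have h₁ : setDist S y T ≤ S.dist y z := setDist_le_dist hz
  have h₂ : S.dist y z ≤ S.dist y x + S.dist x z := hS.dist_triangle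
  have h₃ : S.dist y x = 1 := dist_eq_one_iff_adj.2 hxy.symm
  omega

theorem exists_adj_setDist_lt (hS : S.Connected) (hT : T.Nonempty) (hx : x ∉ T) :
    ∃ y, S.Adj x y ∧ setDist S y T < setDist S x T := by
  obtain ⟨z, hz, h⟩ := exists_dist_eq_setDist S x hT
  obtain ⟨p, hp⟩ := hS.exists_walk_length_eq_dist x z
  cases p with
  | nil => exact absurd hz hx
  | cons hxy q =>
    refine ⟨_, hxy, ?_⟩
    have h₁ := (setDist_le_dist hz).trans (dist_le q)
    rw [Walk.length_cons] at hp
    omega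

theorem exists_walk_avoiding_of_setDist_lt (hS : S.Connected) (hT : T.Nonempty)
    (h : setDist S y T < setDist S x T) : ∃ z ∈ T, ∃ p : S.Walk y z, x ∉ p.support := by
  classical
  obtain ⟨z, hz, hyz⟩ := exists_dist_eq_setDist S y hT
  obtain ⟨p, hp⟩ := hS.exists_walk_length_eq_dist y z
  refine ⟨z, hz, p, fun hx ↦ ?_⟩
  have h₁ : setDist S x T ≤ S.dist x z := setDist_le_dist hz
  have h₂ := dist_le (p.dropUntil x hx)
  have h₃ := p.length_dropUntil_le_length hx
  omega

theorem exists_walk_avoiding_of_induce_connected (hT : (S.induce T).Connected) (hx : x ∉ T)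
    (hy : y ∈ T) (hz : z ∈ T) : ∃ p : S.Walk y z, x ∉ p.support := by
  obtain ⟨p⟩ := hT.preconnected ⟨y, hy⟩ ⟨z, hz⟩
  have hp : x ∉ (p.map (Embedding.induce T).toHom).support := by
    rw [Walk.support_map, List.mem_map]
    rintro ⟨a, -, rfl⟩
    exact hx a.2
  exact ⟨_, hp⟩

theorem SimpleGraph.IsAcyclic.eq_of_walk_avoiding (hS : S.IsAcyclic) (hxy : S.Adj x y)
    (hxz : S.Adj x z) (p : S.Walk y z) (hp : x ∉ p.support) : y = z := by
  have hb := isAcyclic_iff_forall_adj_isBridge.1 hS hxy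
  have hmem := isBridge_iff_forall_walk_mem_edges.1 hb (p.reverse.cons hxz)
  rw [Walk.edges_cons, List.mem_cons, Walk.edges_reverse, List.mem_reverse] at hmem
  rcases hmem with h | h
  · exact Sym2.congr_right.1 h
  · exact absurd (p.fst_mem_support_of_mem_edges h) hp

/-- In a tree, the neighbours of `x` towards two intersecting subtrees avoiding `x` coincide. -/
theorem SimpleGraph.IsTree.eq_of_setDist_lt (hS : S.IsTree) {T' : Set ι}
    (hT : (S.induce T).Connected) (hT' : (S.induce T').Connected) (hx : x ∉ T) (hx' : x ∉ T')
    (hTT' : (T ∩ T').Nonempty) (hxy : S.Adj x y) (hxz : S.Adj x z)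
    (hy : setDist S y T < setDist S x T) (hz : setDist S z T' < setDist S x T') : y = z := by
  obtain ⟨w, hw, hw'⟩ := hTT'
  obtain ⟨a, ha, p, hp⟩ := exists_walk_avoiding_of_setDist_lt hS.connected ⟨w, hw⟩ hy
  obtain ⟨b, hb, q, hq⟩ := exists_walk_avoiding_of_setDist_lt hS.connected ⟨w, hw'⟩ hz
  obtain ⟨r, hr⟩ := exists_walk_avoiding_of_induce_connected hT hx ha hw
  obtain ⟨s, hs⟩ := exists_walk_avoiding_of_induce_connected hT' hx' hw' hb
  refine hS.isAcyclic.eq_of_walk_avoiding hxy hxz (((p.append r).append s).append q.reverse) ?_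
  simp only [Walk.mem_support_append_iff, Walk.support_reverse, List.mem_reverse]
  tauto

open Classical in
/-- Every vertex set `W` of a graph of treewidth at most `k` has a subset of at most `k + 1`
vertices whose removal splits `W` into parts, with no edges between them, of at most half the
size. The separator is the part in `W` of a bag minimizing the total distance to the subtrees
of the vertices of `W`. -/
theorem HasTreeDecompWidthLe.exists_balanced_separator {V : Type*} [Finite V]
    {H : SimpleGraph V} {k : ℕ} (h : HasTreeDecompWidthLe H k) (W : Finset V) :
    ∃ (κ : Type) (X : Finset V) (d : V → κ), X ⊆ W ∧ #X ≤ k + 1 ∧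
      (∀ u ∈ W \ X, ∀ v ∈ W \ X, H.Adj u v → d u = d v) ∧
      ∀ y, 2 * #{u ∈ W \ X | d u = y} ≤ #W := by
  obtain ⟨κ, S, B, hS, hconn, hedge, hcard⟩ := h
  let T : V → Set κ := fun u ↦ {x | u ∈ B x}
  have hT : ∀ u, (T u).Nonempty := fun u ↦ Set.nonempty_coe_sort.1 (hconn u).nonempty
  have : Nonempty κ := hS.connected.nonempty
  let F : κ → ℕ := fun x ↦ ∑ u ∈ W, setDist S x (T u)
  obtain ⟨x, hx⟩ : ∃ x, ∀ y, F x ≤ F y :=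
    ⟨Function.argmin F, fun y ↦ Function.argmin_le F y⟩
  have hdir : ∀ u, ∃ y, x ∉ T u → S.Adj x y ∧ setDist S y (T u) < setDist S x (T u) := by
    intro u
    by_cases hu : x ∈ T u
    · exact ⟨x, fun h ↦ absurd hu h⟩
    · obtain ⟨y, hy⟩ := exists_adj_setDist_lt hS.connected (hT u) hu
      exact ⟨y, fun _ ↦ hy⟩
  choose d hd using hdir
  have hmem : ∀ u ∈ W \ {u ∈ W | u ∈ B x}, u ∈ W ∧ x ∉ T u := by
    intro u hu
    simp only [mem_sdiff, mem_filter, not_and] at hu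
    exact ⟨hu.1, hu.2 hu.1⟩
  refine ⟨κ, {u ∈ W | u ∈ B x}, d, filter_subset _ _, ?_, ?_, ?_⟩
  · rw [← Set.ncard_coe_finset]
    refine (Set.ncard_le_ncard (fun u hu ↦ ?_) (Set.toFinite _)).trans (hcard x)
    exact (mem_filter.1 (mem_coe.1 hu)).2
  · intro u hu v hv huv
    have hu' := (hmem u hu).2
    have hv' := (hmem v hv).2
    exact hS.eq_of_setDist_lt (hconn u) (hconn v) hu' hv' (hedge u v huv) (hd u hu').1
      (hd v hv').1 (hd u hu').2 (hd v hv').2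
  · intro y
    set P : Finset V := {u ∈ W \ {u ∈ W | u ∈ B x} | d u = y} with hP
    have hPW : P ⊆ W := (filter_subset _ _).trans sdiff_subset
    obtain hP₀ | ⟨v, hv⟩ := P.eq_empty_or_nonempty
    · simp [hP₀]
    have hmemP : ∀ u ∈ P, S.Adj x y ∧ setDist S y (T u) < setDist S x (T u) := by
      intro u hu
      obtain ⟨hu₁, hu₂⟩ := mem_filter.1 hu
      exact hu₂ ▸ hd u (hmem u hu₁).2
    have hxy := (hmemP v hv).1
    have h₁ : ∑ u ∈ P, (setDist S y (T u) + 1) ≤ ∑ u ∈ P, setDist S x (T u) :=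
      sum_le_sum fun u hu ↦ (hmemP u hu).2
    have h₂ : ∑ u ∈ W \ P, setDist S y (T u) ≤ ∑ u ∈ W \ P, (setDist S x (T u) + 1) :=
      sum_le_sum fun u _ ↦ setDist_le_add_one hS.connected (hT u) hxy
    rw [sum_add_distrib, sum_const, smul_eq_mul, mul_one] at h₁ h₂
    have h₃ := hx y
    simp only [F] at h₃
    rw [← sum_sdiff hPW, ← sum_sdiff hPW] at h₃
    have h₄ := card_sdiff_add_card_eq_card hPW
    omega

end Separator

section Slots

/-- A slot consists of a level `j` and an index `t`. For a fixed block size `K`, the index `t`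
belongs to the cell `t / K`, which stands for the positions
`[t / K * (K * 2 ^ j), (t / K + 1) * (K * 2 ^ j))` of the line `ℕ`. -/
abbrev Slot := Σ _ : ℕ, ℕ

/-- The slot `a` is joined to the slots `b` of at most its level whose cell starts in the cell
of `a` or in one of the next two. -/
def SlotRel (K : ℕ) (a b : Slot) : Prop :=
  b.1 ≤ a.1 ∧ a.2 / K ≤ b.2 / K / 2 ^ (a.1 - b.1) ∧ b.2 / K / 2 ^ (a.1 - b.1) ≤ a.2 / K + 2

/-- The slots available to a vertex set of size `m` that is placed on the positions
`[x, x + m)`. -/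
def InRange (K x m : ℕ) (a : Slot) : Prop :=
  ∃ p, x ≤ p ∧ p < x + m ∧ a.2 / K = p / (K * 2 ^ a.1) ∧ (a.1 = 0 → a.2 = p) ∧
    (a.1 ≠ 0 → p + K * 2 ^ a.1 ≤ x + m)

variable {K x m x' m' : ℕ} {a b : Slot}

theorem InRange.mono (h : InRange K x m a) (hx : x' ≤ x) (hm : x + m ≤ x' + m') :
    InRange K x' m' a := by
  obtain ⟨p, h₁, h₂, h₃, h₄, h₅⟩ := h
  exact ⟨p, by omega, by omega, h₃, h₄, fun h ↦ (h₅ h).trans hm⟩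

theorem InRange.ne (hK : 0 < K) (ha : InRange K x m a) (hb : InRange K x' m' b)
    (h : x + m ≤ x') : a ≠ b := by
  rintro rfl
  obtain ⟨p, h₁, h₂, h₃, h₄, h₅⟩ := ha
  obtain ⟨q, g₁, g₂, g₃, g₄, g₅⟩ := hb
  by_cases h₀ : a.1 = 0
  · have := h₄ h₀
    have := g₄ h₀
    omega
  · have h₆ : p + K * 2 ^ a.1 ≤ q := by
      have := h₅ h₀
      omega
    have h₇ := Nat.div_le_div_right (c := K * 2 ^ a.1) h₆
    rw [Nat.add_div_right _ (by positivity)] at h₇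
    omega

theorem InRange.slotRel (hK : 0 < K) (ha : a.2 / K = x / (K * 2 ^ a.1)) (hba : b.1 ≤ a.1)
    (hm : m ≤ K * 2 ^ (a.1 + 1)) (hb : InRange K x m b) : SlotRel K a b := by
  obtain ⟨p, h₁, h₂, h₃, -, -⟩ := hb
  have hpow : K * 2 ^ b.1 * 2 ^ (a.1 - b.1) = K * 2 ^ a.1 := by
    rw [mul_assoc, ← pow_add, Nat.add_sub_cancel' hba]
  have hq : b.2 / K / 2 ^ (a.1 - b.1) = p / (K * 2 ^ a.1) := by
    rw [h₃, Nat.div_div_eq_div_mul, hpow]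
  refine ⟨hba, ?_, ?_⟩
  · rw [hq, ha]
    exact Nat.div_le_div_right h₁
  · rw [hq, ha, ← Nat.add_mul_div_left x 2 (by positivity : 0 < K * 2 ^ a.1)]
    refine Nat.div_le_div_right ?_
    rw [pow_succ] at hm
    linarith

theorem InRange.lt_div (hK : 0 < K) {n : ℕ} (h : InRange K 0 n a) : a.2 < n / 2 ^ a.1 := by
  obtain ⟨p, -, h₂, h₃, h₄, h₅⟩ := h
  by_cases h₀ : a.1 = 0
  · rw [h₀, pow_zero, Nat.div_one, h₄ h₀]
    omega
  · have h₆ := h₅ h₀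
    have h₇ : a.2 / K * (K * 2 ^ a.1) ≤ p := h₃ ▸ Nat.div_mul_le_self _ _
    have h₈ : a.2 + 1 ≤ (a.2 / K + 1) * K := by
      have := Nat.lt_mul_div_succ a.2 hK
      linarith
    have h₉ := Nat.mul_le_mul_right (2 ^ a.1) h₈
    refine (Nat.le_div_iff_mul_le (by positivity)).2 ?_
    nlinarith

/-- All slots of level at most `log₂ n` available to a set of `n` vertices. -/
def slots (n : ℕ) : Finset Slot :=
  (range (Nat.log 2 n + 1)).sigma fun j ↦ range (n / 2 ^ j)

theorem card_slots_le (n : ℕ) : #(slots n) ≤ 2 * n := by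
  rw [slots, card_sigma]
  simp only [card_range]
  have := Nat.geom_sum_le (b := 2) le_rfl n (Nat.log 2 n + 1)
  omega

open Classical in
theorem card_filter_slotRel_le (hK : 0 < K) (n : ℕ) (b : Slot) :
    #{a ∈ slots n | SlotRel K a b} ≤ (Nat.log 2 n + 1) * (3 * K) := by
  let q : ℕ → ℕ := fun j ↦ b.2 / K / 2 ^ (j - b.1)
  have hsub : {a ∈ slots n | SlotRel K a b} ⊆ (range (Nat.log 2 n + 1)).sigma
      fun j ↦ Ico ((q j - 2) * K) ((q j + 1) * K) := by
    intro a ha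
    obtain ⟨ha₁, -, h₂, h₃⟩ := mem_filter.1 ha
    refine mem_sigma.2 ⟨(mem_sigma.1 ha₁).1, mem_Ico.2 ⟨?_, ?_⟩⟩
    · exact (Nat.le_div_iff_mul_le hK).1 (Nat.sub_le_of_le_add h₃)
    · exact (Nat.div_lt_iff_lt_mul hK).1 (Nat.lt_succ_of_le h₂)
  refine (card_le_card hsub).trans ?_
  rw [card_sigma, ← smul_eq_mul]
  refine (sum_le_card_nsmul _ _ (3 * K) fun j _ ↦ ?_).trans_eq (by rw [card_range])
  rw [Nat.card_Ico, ← Nat.sub_mul]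
  exact Nat.mul_le_mul_right K (by omega)

/-- The universal graph: the slots for `n` vertices, with adjacency the symmetric closure of
`SlotRel K`. -/
def slotGraph (K n : ℕ) : SimpleGraph (slots n) :=
  SimpleGraph.fromRel fun a b ↦ SlotRel K a b

theorem ncard_edgeSet_slotGraph_le (hK : 0 < K) (n : ℕ) :
    (slotGraph K n).edgeSet.ncard ≤ 2 * n * ((Nat.log 2 n + 1) * (3 * K)) := by
  classical
  let E : Finset (Σ _ : Slot, Slot) := (slots n).sigma fun b ↦ {a ∈ slots n | SlotRel K a b}
  have hE : #E ≤ 2 * n * ((Nat.log 2 n + 1) * (3 * K)) := by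
    rw [card_sigma]
    refine (sum_le_card_nsmul _ _ _ fun b _ ↦ card_filter_slotRel_le hK n b).trans ?_
    rw [smul_eq_mul]
    exact Nat.mul_le_mul_right _ (card_slots_le n)
  have hsub : Sym2.map Subtype.val '' (slotGraph K n).edgeSet ⊆
      ((E.image fun e ↦ s(e.1, e.2) : Finset (Sym2 Slot)) : Set (Sym2 Slot)) := by
    rintro _ ⟨e, he, rfl⟩
    induction e using Sym2.ind with
    | _ a b =>
      rw [mem_edgeSet, slotGraph, fromRel_adj] at he
      rw [coe_image]
      rcases he.2 with h | h
      · exact ⟨⟨b, a⟩, by simp [E, h], Sym2.eq_swap⟩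
      · exact ⟨⟨a, b⟩, by simp [E, h], rfl⟩
  rw [← Set.ncard_image_of_injective _ (Sym2.map.injective Subtype.val_injective)]
  refine (Set.ncard_le_ncard hsub (finite_toSet _)).trans ?_
  rw [Set.ncard_coe_finset]
  exact card_image_le.trans hE

end Slots

section Embedding

variable {V : Type*}

/-- `H[W]` can be placed injectively on slots of level at most `J` that are available for the
positions `[x, x + #W)`, such that adjacent vertices get joined slots. -/
def Placeable (H : SimpleGraph V) (K J : ℕ) (W : Finset V) (x : ℕ) : Prop :=
  ∃ f : V → Slot, Set.InjOn f W ∧ (∀ u ∈ W, InRange K x #W (f u) ∧ (f u).1 ≤ J) ∧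
    ∀ u ∈ W, ∀ v ∈ W, H.Adj u v → SlotRel K (f u) (f v) ∨ SlotRel K (f v) (f u)

variable {H : SimpleGraph V} {K J x : ℕ} {W W₁ W₂ : Finset V}

theorem Placeable.mono {J' : ℕ} (h : Placeable H K J W x) (hJ : J ≤ J') :
    Placeable H K J' W x := by
  obtain ⟨f, h₁, h₂, h₃⟩ := h
  exact ⟨f, h₁, fun u hu ↦ ⟨(h₂ u hu).1, (h₂ u hu).2.trans hJ⟩, h₃⟩

theorem placeable_of_card_lt (H : SimpleGraph V) (hK : 0 < K) (hW : #W < 2 * K) (x : ℕ) :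
    Placeable H K 0 W x := by
  classical
  let e : V → ℕ := fun u ↦ if h : u ∈ W then W.equivFin ⟨u, h⟩ else 0
  have he : ∀ u ∈ W, e u < #W := fun u hu ↦ by simp [e, hu]
  have hinj : ∀ u ∈ W, ∀ v ∈ W, e u = e v → u = v := by
    intro u hu v hv huv
    simpa [e, hu, hv, Fin.val_inj] using huv
  refine ⟨fun u ↦ ⟨0, x + e u⟩, ?_, fun u hu ↦ ⟨⟨x + e u, ?_⟩, le_rfl⟩, ?_⟩
  · intro u hu v hv huv
    simp only [Sigma.mk.injEq, heq_eq_eq, true_and] at huv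
    exact hinj u hu v hv (by omega)
  · have := he u hu
    simp [this]
  · have key : ∀ p q, p ≤ q → q < p + 2 * K → SlotRel K ⟨0, p⟩ ⟨0, q⟩ := by
      intro p q hpq hqp
      refine ⟨le_rfl, ?_, ?_⟩
      · simpa using Nat.div_le_div_right hpq
      · have := Nat.div_le_div_right (c := K) hqp.le
        rwa [mul_comm, Nat.add_mul_div_left _ _ hK, ← Nat.div_one (q / K),
          ← pow_zero 2, ← Nat.sub_self 0] at this
    intro u hu v hv _
    have h₁ := he u hu
    have h₂ := he v hv
    rcases le_total (e u) (e v) with h | h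
    · exact .inl (key _ _ (by omega) (by omega))
    · exact .inr (key _ _ (by omega) (by omega))

theorem Placeable.union [DecidableEq V] (hK : 0 < K) (h₁ : Placeable H K J W₁ x)
    (h₂ : Placeable H K J W₂ (x + #W₁)) (hdisj : Disjoint W₁ W₂)
    (hadj : ∀ u ∈ W₁, ∀ v ∈ W₂, ¬ H.Adj u v) : Placeable H K J (W₁ ∪ W₂) x := by
  obtain ⟨f, f₁, f₂, f₃⟩ := h₁
  obtain ⟨g, g₁, g₂, g₃⟩ := h₂
  have hcard := card_union_of_disjoint hdisj
  let F : V → Slot := fun u ↦ if u ∈ W₁ then f u else g u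
  have hF₁ : ∀ u ∈ W₁, F u = f u := fun u hu ↦ if_pos hu
  have hF₂ : ∀ u ∈ W₂, F u = g u := fun u hu ↦ if_neg (disjoint_right.1 hdisj hu)
  have hne : ∀ u ∈ W₁, ∀ v ∈ W₂, F u ≠ F v := by
    intro u hu v hv
    rw [hF₁ u hu, hF₂ v hv]
    exact (f₂ u hu).1.ne hK (g₂ v hv).1 le_rfl
  refine ⟨F, ?_, ?_, ?_⟩
  · intro u hu v hv huv
    rcases mem_union.1 (mem_coe.1 hu) with hu | hu <;>
      rcases mem_union.1 (mem_coe.1 hv) with hv | hv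
    · rw [hF₁ u hu, hF₁ v hv] at huv
      exact f₁ hu hv huv
    · exact absurd huv (hne u hu v hv)
    · exact absurd huv.symm (hne v hv u hu)
    · rw [hF₂ u hu, hF₂ v hv] at huv
      exact g₁ hu hv huv
  · intro u hu
    rcases mem_union.1 hu with hu | hu
    · rw [hF₁ u hu]
      exact ⟨(f₂ u hu).1.mono le_rfl (by omega), (f₂ u hu).2⟩
    · rw [hF₂ u hu]
      exact ⟨(g₂ u hu).1.mono (by omega) (by omega), (g₂ u hu).2⟩
  · intro u hu v hv huv
    rcases mem_union.1 hu with hu | hu <;> rcases mem_union.1 hv with hv | hv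
    · rw [hF₁ u hu, hF₁ v hv]
      exact f₃ u hu v hv huv
    · exact absurd huv (hadj u hu v hv)
    · exact absurd huv.symm (hadj v hv u hu)
    · rw [hF₂ u hu, hF₂ v hv]
      exact g₃ u hu v hv huv

open Classical in
theorem placeable_of_parts {κ : Type*} (hK : 0 < K) (d : V → κ)
    (hadj : ∀ u ∈ W, ∀ v ∈ W, H.Adj u v → d u = d v)
    (hparts : ∀ y x, Placeable H K J {u ∈ W | d u = y} x) (x : ℕ) : Placeable H K J W x := by
  have key : ∀ Y : Finset κ, ∀ x, Placeable H K J {u ∈ W | d u ∈ Y} x := by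
    intro Y
    induction Y using Finset.induction_on with
    | empty => intro x; exact ⟨fun _ ↦ ⟨0, 0⟩, by simp, by simp, by simp⟩
    | insert y Y hy ih =>
      intro x
      have hsplit : {u ∈ W | d u ∈ insert y Y} = {u ∈ W | d u = y} ∪ {u ∈ W | d u ∈ Y} := by
        simp only [mem_insert, filter_or]
      rw [hsplit]
      refine (hparts y x).union hK (ih _) ?_ ?_
      · refine disjoint_filter.2 fun u _ hu ↦ ?_
        rwa [hu]
      · intro u hu v hv huv
        rw [mem_filter] at hu hv
        exact hy (hu.2 ▸ hadj u hu.1 v hv.1 huv ▸ hv.2)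
  have hW := key (W.image d) x
  rwa [filter_true_of_mem fun u hu ↦ mem_image_of_mem d hu] at hW

open Classical in
theorem Placeable.of_sdiff {X : Finset V} (hXK : #X ≤ K) (hK : 0 < K)
    (hW : K * 2 ^ (J + 1) ≤ #W) (hW' : #W < K * 2 ^ (J + 2)) (h : Placeable H K J (W \ X) x) :
    Placeable H K (J + 1) W x := by
  obtain ⟨f, f₁, f₂, f₃⟩ := h
  let e : V → ℕ := fun u ↦ if h : u ∈ X then X.equivFin ⟨u, h⟩ else 0
  have he : ∀ u ∈ X, e u < K := fun u hu ↦ by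
    have := (X.equivFin ⟨u, hu⟩).2
    simp only [e, hu, dif_pos]
    omega
  have hinj : ∀ u ∈ X, ∀ v ∈ X, e u = e v → u = v := by
    intro u hu v hv huv
    simpa [e, hu, hv, Fin.val_inj] using huv
  let c := x / (K * 2 ^ (J + 1))
  let F : V → Slot := fun u ↦ if u ∈ X then ⟨J + 1, e u + K * c⟩ else f u
  have hFX : ∀ u ∈ X, F u = ⟨J + 1, e u + K * c⟩ := fun u hu ↦ if_pos hu
  have hFn : ∀ u ∉ X, F u = f u := fun u hu ↦ if_neg hu
  have hcell : ∀ u ∈ X, (F u).2 / K = c := by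
    intro u hu
    rw [hFX u hu]
    simp only
    rw [Nat.add_mul_div_left _ _ hK, Nat.div_eq_of_lt (he u hu), zero_add]
  have hlev : ∀ u ∈ X, (F u).1 = J + 1 := fun u hu ↦ by rw [hFX u hu]
  have hlev' : ∀ u ∈ W, u ∉ X → (F u).1 ≤ J := by
    intro u hu hu'
    rw [hFn u hu']
    exact (f₂ u (mem_sdiff.2 ⟨hu, hu'⟩)).2
  have hpos : 0 < K * 2 ^ (J + 1) := by positivity
  have hrange : ∀ u ∈ W, InRange K x #W (F u) ∧ (F u).1 ≤ J + 1 := by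
    intro u hu
    by_cases hu' : u ∈ X
    · have h₁ := hlev u hu'
      refine ⟨⟨x, le_rfl, by omega, ?_, fun h ↦ by omega, fun _ ↦ ?_⟩, h₁.le⟩
      · rw [hcell u hu', h₁]
      · rw [h₁]
        omega
    · have hu'' := f₂ u (mem_sdiff.2 ⟨hu, hu'⟩)
      rw [hFn u hu']
      refine ⟨hu''.1.mono le_rfl ?_, by omega⟩
      have := card_le_card (sdiff_subset : W \ X ⊆ W)
      omega
  have hrel : ∀ u ∈ X, ∀ v ∈ W, SlotRel K (F u) (F v) := by
    intro u hu v hv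
    refine (hrange v hv).1.slotRel hK ?_ ?_ ?_
    · rw [hcell u hu, hlev u hu]
    · rw [hlev u hu]
      exact (hrange v hv).2
    · rw [hlev u hu]
      exact hW'.le
  refine ⟨F, ?_, hrange, ?_⟩
  · intro u hu v hv huv
    rw [mem_coe] at hu hv
    by_cases hu' : u ∈ X <;> by_cases hv' : v ∈ X
    · rw [hFX u hu', hFX v hv'] at huv
      simp only [Sigma.mk.injEq, heq_eq_eq, true_and] at huv
      exact hinj u hu' v hv' (by omega)
    · have h₁ := hlev u hu'
      have h₂ := hlev' v hv hv'
      rw [huv] at h₁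
      omega
    · have h₁ := hlev v hv'
      have h₂ := hlev' u hu hu'
      rw [huv] at h₂
      omega
    · rw [hFn u hu', hFn v hv'] at huv
      exact f₁ (by simp [hu, hu']) (by simp [hv, hv']) huv
  · intro u hu v hv huv
    by_cases hu' : u ∈ X
    · exact .inl (hrel u hu' v hv)
    by_cases hv' : v ∈ X
    · exact .inr (hrel v hv' u hu)
    rw [hFn u hu', hFn v hv']
    exact f₃ u (mem_sdiff.2 ⟨hu, hu'⟩) v (mem_sdiff.2 ⟨hv, hv'⟩) huv

theorem HasTreeDecompWidthLe.placeable [Finite V] {k : ℕ} (h : HasTreeDecompWidthLe H k)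
    (hW : #W < (k + 1) * 2 ^ (J + 1)) (x : ℕ) : Placeable H (k + 1) J W x := by
  classical
  induction J generalizing W x with
  | zero => exact placeable_of_card_lt H k.succ_pos (by omega) x
  | succ J ih =>
    by_cases hWJ : #W < (k + 1) * 2 ^ (J + 1)
    · exact (ih hWJ x).mono J.le_succ
    obtain ⟨κ, X, d, -, hXk, hadj, hparts⟩ := h.exists_balanced_separator W
    refine Placeable.of_sdiff hXk k.succ_pos (not_lt.1 hWJ) hW ?_
    refine placeable_of_parts k.succ_pos d hadj (fun y x ↦ ih ?_ x) x
    have h₁ := hparts y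
    rw [pow_succ, ← mul_assoc] at hW
    omega

theorem HasTreeDecompWidthLe.slotGraph_contains {n k : ℕ} {H : SimpleGraph (Fin n)}
    (h : HasTreeDecompWidthLe H k) : Contains (slotGraph (k + 1) n) H := by
  have hn : #(univ : Finset (Fin n)) < (k + 1) * 2 ^ (Nat.log 2 n + 1) := by
    rw [card_univ, Fintype.card_fin]
    exact (Nat.lt_pow_succ_log_self one_lt_two n).trans_le
      (Nat.le_mul_of_pos_left _ k.succ_pos)
  obtain ⟨f, f₁, f₂, f₃⟩ := h.placeable hn 0
  rw [card_univ, Fintype.card_fin] at f₂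
  have hf : ∀ u, f u ∈ slots n := fun u ↦
    mem_sigma.2 ⟨mem_range.2 (Nat.lt_succ_of_le (f₂ u (mem_univ u)).2),
      mem_range.2 ((f₂ u (mem_univ u)).1.lt_div k.succ_pos)⟩
  have hinj : Function.Injective fun u ↦ (⟨f u, hf u⟩ : slots n) := fun u v huv ↦
    f₁ (by simp) (by simp) (congrArg Subtype.val huv)
  refine ⟨_, hinj, fun u v huv ↦ ?_⟩
  rw [slotGraph, fromRel_adj]
  exact ⟨hinj.ne huv.ne, f₃ u (mem_univ u) v (mem_univ v) huv⟩

end Embedding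

/-- There is a constant `C` such that for all `n ≥ 2` and `k ≥ 1` there is a graph with at most
`C·k·n·log₂ n` edges containing every `n`-vertex graph of treewidth at most `k`. -/
theorem statement1 :
    ∃ C : ℝ, ∀ n k : ℕ, 2 ≤ n → 1 ≤ k →
      ∃ (M : ℕ) (G : SimpleGraph (Fin M)),
        (G.edgeSet.ncard : ℝ) ≤ C * k * n * Real.logb 2 n ∧
        ∀ H : SimpleGraph (Fin n), HasTreeDecompWidthLe H k → Contains G H := by
  refine ⟨24, fun n k hn hk ↦ ?_⟩
  let e := (slots n).equivFin
  let φ : slotGraph (k + 1) n ≃g (slotGraph (k + 1) n).map e.toEmbedding := Iso.map e _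
  refine ⟨#(slots n), (slotGraph (k + 1) n).map e.toEmbedding, ?_, fun H hH ↦ ?_⟩
  · have hcard : ((slotGraph (k + 1) n).map e.toEmbedding).edgeSet.ncard ≤
        2 * n * ((Nat.log 2 n + 1) * (3 * (k + 1))) := by
      rw [edgeSet_map, Set.ncard_image_of_injective _ e.toEmbedding.sym2Map.injective]
      exact ncard_edgeSet_slotGraph_le k.succ_pos n
    have hlog : (Nat.log 2 n : ℝ) ≤ Real.logb 2 n := by
      simpa using Real.natLog_le_logb n 2
    have hlog₁ : (1 : ℝ) ≤ Real.logb 2 n := by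
      refine le_trans ?_ hlog
      exact_mod_cast Nat.log_pos one_lt_two hn
    have hk' : (1 : ℝ) ≤ k := by exact_mod_cast hk
    calc _ ≤ ((2 * n * ((Nat.log 2 n + 1) * (3 * (k + 1))) : ℕ) : ℝ) := by exact_mod_cast hcard
      _ = 2 * n * ((Nat.log 2 n + 1) * (3 * (k + 1))) := by push_cast; ring
      _ ≤ 2 * n * ((2 * Real.logb 2 n) * (3 * (2 * k))) := by gcongr <;> linarith
      _ = 24 * k * n * Real.logb 2 n := by ring
  · obtain ⟨f, hf, hadj⟩ := hH.slotGraph_contains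
    exact ⟨fun u ↦ φ (f u), φ.injective.comp hf, fun u v huv ↦ φ.map_rel_iff.2 (hadj u v huv)⟩
end

section
/- There is a constant C such that for every integer n ≥ 1 there exists a simple graph G on exactly n vertices with at most (7/2)·n·log₂ n + C·n edges that contains every tree on n vertices. -/
open Finset

namespace UniversalTree

/-- No edge of `T` joins `X` to a vertex of `D \ X` other than `w`. -/
def IsClosedOff {V : Type*} (T : SimpleGraph V) (D : Finset V) (w : V) (X : Finset V) : Prop :=
  ∀ u ∈ X, ∀ v ∈ D, v ≠ w → v ∉ X → ¬ T.Adj u v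

/-- In an acyclic graph, a vertex has at most one neighbour in each component of a subgraph
avoiding it. -/
lemma neighbor_unique_of_reachable {V : Type*} {T H : SimpleGraph V} (hT : T.IsAcyclic)
    (hH : H ≤ T) {w a b : V} (hw : ∀ x, ¬ H.Adj w x) (ha : T.Adj w a) (hb : T.Adj w b)
    (hab : H.Reachable a b) : a = b := by
  by_contra hne
  have hbr := SimpleGraph.isAcyclic_iff_forall_adj_isBridge.mp hT ha
  rw [SimpleGraph.isBridge_iff] at hbr
  apply hbr
  have hle : H ≤ T.deleteEdges {s(w, a)} := by
    intro x z hxz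
    rw [SimpleGraph.deleteEdges_adj]
    refine ⟨hH hxz, ?_⟩
    intro h
    rcases Sym2.eq_iff.mp (Set.mem_singleton_iff.mp h) with ⟨rfl, rfl⟩ | ⟨rfl, rfl⟩
    · exact hw _ hxz
    · exact hw _ hxz.symm
  have hwb : (T.deleteEdges {s(w, a)}).Adj w b := by
    rw [SimpleGraph.deleteEdges_adj]
    refine ⟨hb, ?_⟩
    intro h
    rcases Sym2.eq_iff.mp (Set.mem_singleton_iff.mp h) with ⟨_, h⟩ | ⟨h, _⟩
    · exact hne h.symm
    · exact ha.ne h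
  exact hwb.reachable.trans (hab.mono hle).symm

/-- A set `D` of more than `y` vertices of a forest has a vertex `w` such that a union `X` of
components of `D - w` has between `y / 2` and `y` vertices, and, unless `X` has exactly `y`
vertices, some component `Y` of the rest has at most `y` vertices and overfills `X`. -/
lemma exists_separator {V : Type*} [DecidableEq V] {T : SimpleGraph V} (hT : T.IsAcyclic)
    (D : Finset V) (y : ℕ) (hy : y < D.card) :
    ∃ w ∈ D, ∃ X ⊆ D.erase w, ∃ Y ⊆ D.erase w, Disjoint X Y ∧ X.card ≤ y ∧ y ≤ 2 * X.card ∧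
      Y.card ≤ y ∧ (X.card < y → y < X.card + Y.card) ∧
      IsClosedOff T D w X ∧ IsClosedOff T D w Y := by
  classical
  let P : ℕ → Prop := fun m => ∃ w Q, w ∈ Q ∧ Q ⊆ D ∧ y < Q.card ∧
    IsClosedOff T D w (Q.erase w) ∧ Q.card = m
  have hP : ∃ m, P m := by
    obtain ⟨w, hw⟩ : D.Nonempty := card_pos.mp (by omega)
    refine ⟨_, w, D, hw, Subset.rfl, hy, ?_, rfl⟩
    intro u _ v hv hvw hv'
    exact absurd (mem_erase.mpr ⟨hvw, hv⟩) hv'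
  obtain ⟨w, Q, hwQ, hQD, hyQ, hQcl, hQm⟩ := Nat.find_spec hP
  have hmin : ∀ w' Q', w' ∈ Q' → Q' ⊆ D → y < Q'.card → IsClosedOff T D w' (Q'.erase w') →
      Q.card ≤ Q'.card := by
    intro w' Q' h1 h2 h3 h4
    rw [hQm]
    exact Nat.find_min' hP ⟨w', Q', h1, h2, h3, h4, rfl⟩
  obtain ⟨X, hXm, hXmax⟩ := exists_max_image
    ((Q.erase w).powerset.filter fun X => IsClosedOff T D w X ∧ X.card ≤ y) Finset.card
    ⟨∅, mem_filter.mpr ⟨empty_mem_powerset _, by simp [IsClosedOff], by simp⟩⟩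
  simp only [mem_filter, mem_powerset] at hXm hXmax
  obtain ⟨hXQ, hXcl, hXy⟩ := hXm
  have hQe : Q.erase w ⊆ D.erase w := erase_subset_erase _ hQD
  rcases hXy.eq_or_lt with hXe | hXlt
  · exact ⟨w, hQD hwQ, X, hXQ.trans hQe, ∅, empty_subset _, disjoint_empty_right _, hXy,
      by omega, by simp, by omega, hXcl, by simp [IsClosedOff]⟩
  set Z := Q.erase w \ X with hZ
  have hQc : (Q.erase w).card = Q.card - 1 := card_erase_of_mem hwQ
  obtain ⟨v, hv⟩ : Z.Nonempty := by
    rw [← card_pos, hZ, card_sdiff_of_subset hXQ]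
    omega
  let H : SimpleGraph V :=
    { Adj := fun a b => T.Adj a b ∧ a ∈ Z ∧ b ∈ Z
      symm := ⟨fun a b h => ⟨h.1.symm, h.2.2, h.2.1⟩⟩
      loopless := ⟨fun a h => h.1.ne rfl⟩ }
  have hHT : H ≤ T := fun a b h => h.1
  have hwZ : w ∉ Z := by simp [hZ]
  let Y := Z.filter fun u => H.Reachable v u
  have hYZ : Y ⊆ Z := filter_subset _ _
  have hvY : v ∈ Y := mem_filter.mpr ⟨hv, SimpleGraph.Reachable.refl _⟩
  have hZQ : Z ⊆ Q.erase w := sdiff_subset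
  have hYcl : IsClosedOff T D w Y := by
    intro u hu x hxD hxw hxY hux
    obtain ⟨huZ, hur⟩ := mem_filter.mp hu
    by_cases hxQ : x ∈ Q.erase w
    · by_cases hxX : x ∈ X
      · exact hXcl x hxX u (hQD (mem_of_mem_erase (hZQ huZ))) (ne_of_mem_erase (hZQ huZ))
          (mem_sdiff.mp huZ).2 hux.symm
      · have hxZ : x ∈ Z := mem_sdiff.mpr ⟨hxQ, hxX⟩
        have hadj : H.Adj u x := ⟨hux, huZ, hxZ⟩
        exact hxY (mem_filter.mpr ⟨hxZ, hur.trans hadj.reachable⟩)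
    · exact hQcl u (hZQ huZ) x hxD hxw hxQ hux
  have hYy : Y.card ≤ y := by
    by_contra! hlt
    have hYQ : Y.card < Q.card := by
      have := card_le_card (hYZ.trans hZQ)
      omega
    obtain ⟨w', hw'Y, hw'⟩ : ∃ w' ∈ Y, ∀ u ∈ Y, T.Adj w u → u = w' := by
      by_cases h : ∃ w' ∈ Y, T.Adj w w'
      · obtain ⟨w', hw'Y, hw'⟩ := h
        refine ⟨w', hw'Y, fun u hu huw => ?_⟩
        exact neighbor_unique_of_reachable hT hHT (fun x hx => hwZ hx.2.1) huw hw'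
          ((mem_filter.mp hu).2.symm.trans (mem_filter.mp hw'Y).2)
      · push Not at h
        exact ⟨v, hvY, fun u hu huw => absurd huw (h u hu)⟩
    refine absurd (hmin w' Y hw'Y ?_ hlt ?_) (by omega)
    · exact (hYZ.trans hZQ).trans (hQe.trans (erase_subset _ _))
    · intro u hu x hxD hxw' hx hux
      have hxY : x ∉ Y := fun h => hx (mem_erase.mpr ⟨hxw', h⟩)
      by_cases hxw : x = w
      · subst hxw
        exact ne_of_mem_erase hu (hw' u (mem_of_mem_erase hu) hux.symm)
      · exact hYcl u (mem_of_mem_erase hu) x hxD hxw hxY hux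
  have hXY : Disjoint X Y :=
    disjoint_of_subset_right hYZ (disjoint_sdiff : Disjoint X (Q.erase w \ X))
  have hYX : Y.card ≤ X.card := hXmax Y ⟨hYZ.trans hZQ, hYcl, hYy⟩
  have hover : y < X.card + Y.card := by
    by_contra! hle
    have hcard : (X ∪ Y).card = X.card + Y.card := card_union_of_disjoint hXY
    have hYpos : 0 < Y.card := card_pos.mpr ⟨v, hvY⟩
    have := hXmax (X ∪ Y) ⟨union_subset hXQ (hYZ.trans hZQ), ?_, by omega⟩
    · omega
    · intro u hu x hxD hxw hx
      rw [mem_union, not_or] at hx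
      rcases mem_union.mp hu with h | h
      · exact hXcl u h x hxD hxw hx.1
      · exact hYcl u h x hxD hxw hx.2
  exact ⟨w, hQD hwQ, X, hXQ.trans hQe, Y, (hYZ.trans hZQ).trans hQe, hXY, hXy, by omega, hYy,
    fun _ => hover, hXcl, hYcl⟩

/-- The subgraph of `T` induced by `A` embeds into the subgraph of `G` induced by `I`. -/
def Embeds {V W : Type*} (T : SimpleGraph V) (G : SimpleGraph W) (A : Finset V) (I : Finset W) :
    Prop :=
  ∃ f : V → W, Set.InjOn f A ∧ (∀ a ∈ A, f a ∈ I) ∧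
    ∀ u ∈ A, ∀ v ∈ A, T.Adj u v → G.Adj (f u) (f v)

namespace Embeds

variable {V W : Type*} {T : SimpleGraph V} {G : SimpleGraph W}

lemma mono {A : Finset V} {I J : Finset W} (h : Embeds T G A I) (hIJ : I ⊆ J) :
    Embeds T G A J := by
  obtain ⟨f, h1, h2, h3⟩ := h
  exact ⟨f, h1, fun a ha => hIJ (h2 a ha), h3⟩

lemma union [DecidableEq V] [DecidableEq W] {A B : Finset V} {I J : Finset W}
    (hA : Embeds T G A I) (hB : Embeds T G B J) (hAB : Disjoint A B) (hIJ : Disjoint I J)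
    (hadj : ∀ u ∈ A, ∀ v ∈ B, ¬ T.Adj u v) : Embeds T G (A ∪ B) (I ∪ J) := by
  obtain ⟨f, f1, f2, f3⟩ := hA
  obtain ⟨g, g1, g2, g3⟩ := hB
  have hf : ∀ a ∈ A, (if a ∈ A then f a else g a) = f a := fun a ha => if_pos ha
  have hg : ∀ b ∈ B, (if b ∈ A then f b else g b) = g b :=
    fun b hb => if_neg (disjoint_right.mp hAB hb)
  refine ⟨fun x => if x ∈ A then f x else g x, ?_, ?_, ?_⟩
  · intro x hx z hz hxz
    simp only [coe_union, Set.mem_union, mem_coe] at hx hz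
    dsimp only at hxz
    rcases hx with hx | hx <;> rcases hz with hz | hz
    · rw [hf x hx, hf z hz] at hxz
      exact f1 hx hz hxz
    · rw [hf x hx, hg z hz] at hxz
      exact absurd (g2 z hz) (hxz ▸ disjoint_left.mp hIJ (f2 x hx))
    · rw [hg x hx, hf z hz] at hxz
      exact absurd (g2 x hx) (hxz ▸ disjoint_left.mp hIJ (f2 z hz))
    · rw [hg x hx, hg z hz] at hxz
      exact g1 hx hz hxz
  · intro a ha
    dsimp only
    rcases mem_union.mp ha with ha | ha
    · rw [hf a ha]
      exact mem_union_left _ (f2 a ha)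
    · rw [hg a ha]
      exact mem_union_right _ (g2 a ha)
  · intro u hu v hv huv
    dsimp only
    rcases mem_union.mp hu with hu | hu <;> rcases mem_union.mp hv with hv | hv
    · rw [hf u hu, hf v hv]
      exact f3 u hu v hv huv
    · exact absurd huv (hadj u hu v hv)
    · exact absurd huv.symm (hadj v hv u hu)
    · rw [hg u hu, hg v hv]
      exact g3 u hu v hv huv

lemma cone [DecidableEq V] [DecidableEq W] {A : Finset V} {I : Finset W} {w : V} {p : W}
    (hA : Embeds T G A I) (hw : w ∉ A) (hp : p ∉ I) (hadj : ∀ x ∈ I, G.Adj p x) :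
    Embeds T G (insert w A) (insert p I) := by
  obtain ⟨f, f1, f2, f3⟩ := hA
  have hf : ∀ a ∈ A, Function.update f w p a = f a := fun a ha =>
    Function.update_of_ne (ne_of_mem_of_not_mem ha hw) _ _
  have hfw : Function.update f w p w = p := Function.update_self _ _ _
  refine ⟨Function.update f w p, ?_, ?_, ?_⟩
  · intro x hx z hz hxz
    rcases mem_insert.mp (mem_coe.mp hx) with hxw | hxA <;>
      rcases mem_insert.mp (mem_coe.mp hz) with hzw | hzA
    · rw [hxw, hzw]
    · rw [hxw, hfw, hf z hzA] at hxz
      exact absurd (f2 z hzA) (hxz ▸ hp)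
    · rw [hzw, hfw, hf x hxA] at hxz
      exact absurd (f2 x hxA) (hxz ▸ hp)
    · rw [hf x hxA, hf z hzA] at hxz
      exact f1 hxA hzA hxz
  · intro a ha
    rcases mem_insert.mp ha with rfl | ha
    · rw [hfw]
      exact mem_insert_self _ _
    · rw [hf a ha]
      exact mem_insert_of_mem (f2 a ha)
  · intro u hu v hv huv
    rcases mem_insert.mp hu with huw | huA <;> rcases mem_insert.mp hv with hvw | hvA
    · exact absurd (huw.trans hvw.symm) huv.ne
    · rw [huw, hfw, hf v hvA]
      exact hadj _ (f2 v hvA)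
    · rw [hvw, hfw, hf u huA]
      exact (hadj _ (f2 u huA)).symm
    · rw [hf u huA, hf v hvA]
      exact f3 u huA v hvA huv

lemma empty [Nonempty W] (I : Finset W) : Embeds T G ∅ I :=
  ⟨fun _ => Classical.arbitrary W, by simp, by simp, by simp⟩

end Embeds

/-- The positions joined to `b + t` when `b` is an odd multiple of `2 ^ (t + j)`. -/
def window (b t j : ℕ) : Finset ℕ :=
  Ico (b - 2 ^ j) b ∪ Ioc (b + t) (b + t + 2 ^ (j + 1))

lemma card_window_le (b t j : ℕ) : (window b t j).card ≤ 3 * 2 ^ j := by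
  refine (card_union_le _ _).trans ?_
  rw [Nat.card_Ico, Nat.card_Ioc, pow_succ]
  omega

/-- The graph on `ℕ` in which each position `b + t`, where `b` is an odd multiple of
`2 ^ (t + j)`, is joined to its window. -/
def hubGraph : SimpleGraph ℕ :=
  SimpleGraph.fromRel fun u x => ∃ c t j, u = 2 ^ (t + j) * (2 * c + 1) + t ∧
    x ∈ window (2 ^ (t + j) * (2 * c + 1)) t j

lemma hubGraph_adj_of_mem_window {c t j x : ℕ}
    (hx : x ∈ window (2 ^ (t + j) * (2 * c + 1)) t j) :
    hubGraph.Adj (2 ^ (t + j) * (2 * c + 1) + t) x := by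
  rw [hubGraph, SimpleGraph.fromRel_adj]
  refine ⟨?_, Or.inl ⟨c, t, j, rfl, hx⟩⟩
  simp only [window, mem_union, mem_Ico, mem_Ioc] at hx
  omega

/-- One separator step: `w` goes to the position `b + t`, the set `X` to the start of the space
before `b`, and `Y` fills up that space, overflowing to the positions from `b + t + 1` on. -/
lemma embeds_of_separator {V : Type*} [DecidableEq V] {T : SimpleGraph V}
    {ℓ : ℕ} (ih : ∀ (A : Finset V) (a : ℕ), A.card < ℓ → 1 ≤ a →
      Embeds T hubGraph A (Ico a (a + A.card)))
    {b c j t y : ℕ} {D X Y : Finset V} {w : V} (hb : b = 2 ^ (t + j) * (2 * c + 1))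
    (hD : D.card ≤ ℓ) (hyD : y < D.card) (hyj : y < 2 ^ j) (hDj : D.card ≤ y + 2 ^ (j + 1))
    (hyb : y < b) (hw : w ∈ D) (hXD : X ⊆ D.erase w) (hYD : Y ⊆ D.erase w) (hXY : Disjoint X Y)
    (hXy : X.card ≤ y) (hover : y ≤ X.card + Y.card)
    (hX : IsClosedOff T D w X) (hY : IsClosedOff T D w Y)
    (hYemb : Embeds T hubGraph Y (Ico (b - (y - X.card)) b ∪
      Ico (b + (t + 1)) (b + (t + 1) + (Y.card - (y - X.card))))) :
    Embeds T hubGraph D (Ico (b - y) b ∪ Ico (b + t) (b + t + (D.card - y))) := by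
  set R := D.erase w \ (X ∪ Y)
  have hDc : (D.erase w).card = D.card - 1 := card_erase_of_mem hw
  have hXYc : (X ∪ Y).card = X.card + Y.card := card_union_of_disjoint hXY
  have hRc : R.card + (X.card + Y.card) = D.card - 1 := by
    rw [← hXYc, ← hDc]
    exact card_sdiff_add_card_eq_card (union_subset hXD hYD)
  have hXemb := ih X (b - y) (by omega) (by omega)
  have hRemb := ih R (b + (t + 1) + (Y.card - (y - X.card))) (by omega) (by omega)
  have hXYemb := hXemb.union hYemb hXY (by
    rw [disjoint_left]
    intro x
    simp only [mem_union, mem_Ico]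
    omega) fun u hu v hv => hX u hu v (mem_of_mem_erase (hYD hv)) (ne_of_mem_erase (hYD hv))
      (disjoint_right.mp hXY hv)
  have hall := hXYemb.union hRemb disjoint_sdiff (by
    rw [disjoint_left]
    intro x
    simp only [mem_union, mem_Ico]
    omega) (by
    intro u hu v hv
    obtain ⟨hvD, hvXY⟩ := mem_sdiff.mp hv
    rw [mem_union, not_or] at hvXY
    rcases mem_union.mp hu with hu | hu
    · exact hX u hu v (mem_of_mem_erase hvD) (ne_of_mem_erase hvD) hvXY.1
    · exact hY u hu v (mem_of_mem_erase hvD) (ne_of_mem_erase hvD) hvXY.2)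
  have hunion : X ∪ Y ∪ R = D.erase w := union_sdiff_of_subset (union_subset hXD hYD)
  rw [hunion] at hall
  have hcone := hall.cone (p := b + t) (notMem_erase w D) (by
    simp only [mem_union, mem_Ico]
    omega) (by
    intro x hx
    rw [hb]
    apply hubGraph_adj_of_mem_window
    rw [← hb]
    simp only [window, mem_union, mem_Ico, mem_Ioc] at hx ⊢
    omega)
  rw [insert_erase hw] at hcone
  refine hcone.mono ?_
  intro x
  simp only [mem_insert, mem_union, mem_Ico]
  omega

/-- Embedding around an anchor `b`, an odd multiple of `2 ^ (t + j)`: exactly `y` vertices go just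
before `b`, the others go from `b + t` on. -/
lemma embeds_around_anchor {V : Type*} [DecidableEq V] {T : SimpleGraph V} (hT : T.IsAcyclic)
    {ℓ : ℕ} (ih : ∀ (A : Finset V) (a : ℕ), A.card < ℓ → 1 ≤ a →
      Embeds T hubGraph A (Ico a (a + A.card)))
    {c b : ℕ} (j : ℕ) : ∀ (t y : ℕ) (D : Finset V), b = 2 ^ (t + j) * (2 * c + 1) → D.card ≤ ℓ →
      y < D.card → y < 2 ^ j → D.card ≤ y + 2 ^ (j + 1) → y < b →
      Embeds T hubGraph D (Ico (b - y) b ∪ Ico (b + t) (b + t + (D.card - y))) := by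
  induction j with
  | zero =>
    intro t y D hb hD hyD hyj hDj hyb
    obtain ⟨w, hw⟩ : D.Nonempty := card_pos.mp (by omega)
    rw [pow_zero] at hyj
    exact embeds_of_separator (X := ∅) (Y := ∅) ih hb hD hyD (by simpa using hyj) hDj hyb hw
      (empty_subset _) (empty_subset _) (disjoint_empty_left _) (by simp) (by simp; omega)
      (by simp [IsClosedOff]) (by simp [IsClosedOff]) (.empty _)
  | succ j IH =>
    intro t y D hb hD hyD hyj hDj hyb
    obtain ⟨w, hw, X, hXD, Y, hYD, hXY, hXy, hX2, hYy, hover, hX, hY⟩ :=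
      exists_separator hT D y hyD
    rcases hXy.eq_or_lt with hXe | hXlt
    · exact embeds_of_separator (X := X) (Y := ∅) ih hb hD hyD hyj hDj hyb hw hXD
        (empty_subset _) (disjoint_empty_right _) hXy (by simp; omega) hX
        (by simp [IsClosedOff]) (.empty _)
    · have hlt := hover hXlt
      rw [pow_succ] at hyj
      refine embeds_of_separator ih hb hD hyD (by rwa [pow_succ]) hDj hyb hw hXD hYD hXY hXy
        hlt.le hX hY (IH (t + 1) (y - X.card) Y ?_ ?_ ?_ ?_ ?_ ?_)
      · rw [hb, add_right_comm, add_assoc]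
      · omega
      · omega
      · omega
      · rw [pow_succ]
        omega
      · omega

/-- Any interval `[a, a + m)` of positive integers with `m ≥ 1` contains an odd multiple `b` of
some `2 ^ k` with `b - 2 ^ k < a` and `a + m ≤ b + 2 ^ k`. -/
lemma exists_anchor (a m : ℕ) (ha : 1 ≤ a) (hm : 1 ≤ m) :
    ∃ k c, a ≤ 2 ^ k * (2 * c + 1) ∧ 2 ^ k * (2 * c + 1) < a + m ∧
      2 ^ k * (2 * c + 1) < a + 2 ^ k ∧ a + m ≤ 2 ^ k * (2 * c + 1) + 2 ^ k := by
  classical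
  let P : ℕ → Prop := fun k => ∃ q, a ≤ 2 ^ k * q ∧ 2 ^ k * q < a + m
  have hP0 : P 0 := ⟨a, by omega, by omega⟩
  have hbound : ∀ k, P k → k ≤ a + m := by
    rintro k ⟨q, h1, h2⟩
    have hq : 0 < q := Nat.pos_of_ne_zero (by rintro rfl; omega)
    have := Nat.le_mul_of_pos_right (2 ^ k) hq
    have := Nat.lt_two_pow_self (n := k)
    omega
  set k := Nat.findGreatest P (a + m)
  obtain ⟨q, h1, h2⟩ : P k := Nat.findGreatest_spec (Nat.zero_le _) hP0
  have hnot : ¬ P (k + 1) := fun h =>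
    absurd (Nat.le_findGreatest (hbound _ h) h) (by omega)
  have hno : ∀ r, a ≤ 2 * (2 ^ k * r) → ¬ 2 * (2 ^ k * r) < a + m := by
    intro r hr1 hr2
    have hr : 2 ^ (k + 1) * r = 2 * (2 ^ k * r) := by ring
    exact hnot ⟨r, by rwa [hr], by rwa [hr]⟩
  obtain ⟨c, rfl | rfl⟩ := q.even_or_odd'
  · have : 2 ^ k * (2 * c) = 2 * (2 ^ k * c) := by ring
    exact absurd (this ▸ h2) (hno c (this ▸ h1))
  · have hc : 2 ^ k * (2 * c + 1) = 2 * (2 ^ k * c) + 2 ^ k := by ring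
    have hc' : 2 * (2 ^ k * (c + 1)) = 2 * (2 ^ k * c) + 2 * 2 ^ k := by ring
    have hlow := hno c
    have hhigh := hno (c + 1)
    refine ⟨k, c, h1, h2, ?_, ?_⟩ <;> omega

/-- Every set of `m` vertices of a forest embeds into every interval of `m` positions. -/
lemma embeds_interval {V : Type*} [DecidableEq V] {T : SimpleGraph V} (hT : T.IsAcyclic)
    (A : Finset V) (a : ℕ) (ha : 1 ≤ a) : Embeds T hubGraph A (Ico a (a + A.card)) := by
  induction hℓ : A.card using Nat.strong_induction_on generalizing A a with
  | _ ℓ ih =>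
    rcases Nat.eq_zero_or_pos ℓ with rfl | hpos
    · rw [card_eq_zero] at hℓ
      subst hℓ
      exact .empty _
    obtain ⟨k, c, h1, h2, h3, h4⟩ := exists_anchor a ℓ ha hpos
    set b := 2 ^ k * (2 * c + 1) with hb
    have := embeds_around_anchor hT (ℓ := ℓ) (b := b) (c := c)
      (fun B a' hB ha' => ih B.card hB B a' ha' rfl) k 0 (b - a) A (by rw [zero_add])
      hℓ.le (by omega) (by omega) (by rw [pow_succ]; omega) (by omega)
    refine this.mono ?_
    intro x hx
    simp only [mem_union, mem_Ico] at hx ⊢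
    omega

/-- The `hubGraph` restricted to the positions `1, …, n`. -/
def hubGraphFin (n : ℕ) : SimpleGraph (Fin n) :=
  hubGraph.comap fun i => (i : ℕ) + 1

lemma contains_hubGraphFin {n : ℕ} {T : SimpleGraph (Fin n)} (hT : T.IsAcyclic) :
    Contains (hubGraphFin n) T := by
  obtain ⟨f, f1, f2, f3⟩ := embeds_interval hT univ 1 le_rfl
  have hf : ∀ i, 1 ≤ f i ∧ f i < n + 1 := by
    intro i
    have := f2 i (mem_univ i)
    rw [mem_Ico, card_univ, Fintype.card_fin] at this
    omega
  refine ⟨fun i => ⟨f i - 1, by have := hf i; omega⟩, ?_, ?_⟩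
  · intro x z hxz
    have h := Fin.mk.inj_iff.mp hxz
    have hx := hf x
    have hz := hf z
    exact f1 (by simp) (by simp) (by omega)
  · intro u v huv
    simp only [hubGraphFin, SimpleGraph.comap_adj]
    rw [Nat.sub_add_cancel (hf u).1, Nat.sub_add_cancel (hf v).1]
    exact f3 u (mem_univ u) v (mem_univ v) huv

/-- A finite set containing all edges of `hubGraph` within `1, …, n`. -/
def hubEdges (n : ℕ) : Finset (Sym2 ℕ) :=
  (range (Nat.log 2 n + 1)).biUnion fun k =>
    (range (n / 2 ^ (k + 1) + 1)).biUnion fun c =>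
      (range (k + 1)).biUnion fun t =>
        (window (2 ^ k * (2 * c + 1)) t (k - t)).image fun x =>
          s(2 ^ k * (2 * c + 1) + t, x)

lemma mem_hubEdges {n c t j x : ℕ} (hn : 2 ^ (t + j) * (2 * c + 1) + t ≤ n)
    (hx : x ∈ window (2 ^ (t + j) * (2 * c + 1)) t j) :
    s(2 ^ (t + j) * (2 * c + 1) + t, x) ∈ hubEdges n := by
  have hpos : 0 < 2 ^ (t + j) := by positivity
  simp only [hubEdges, mem_biUnion, mem_range, mem_image]
  refine ⟨t + j, ?_, c, ?_, t, by omega, x, ?_, rfl⟩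
  · refine Nat.lt_succ_of_le (Nat.le_log_of_pow_le one_lt_two ?_)
    nlinarith
  · refine Nat.lt_succ_of_le ((Nat.le_div_iff_mul_le (by positivity)).mpr ?_)
    rw [pow_succ]
    nlinarith
  · rwa [Nat.add_sub_cancel_left]

lemma sum_two_pow_sub_le (k : ℕ) : ∑ t ∈ range (k + 1), 3 * 2 ^ (k - t) ≤ 6 * 2 ^ k := by
  induction k with
  | zero => simp
  | succ k ih =>
    rw [sum_range_succ']
    simp only [Nat.add_sub_add_right, Nat.sub_zero]
    rw [pow_succ]
    omega

lemma sum_three_mul_add_le (n L : ℕ) :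
    ∑ k ∈ range L, (3 * n + 6 * 2 ^ k) ≤ 3 * n * L + 6 * 2 ^ L := by
  induction L with
  | zero => simp
  | succ L ih =>
    rw [sum_range_succ, pow_succ, mul_add, mul_one]
    omega

lemma card_hubEdges_le {n : ℕ} (hn : 1 ≤ n) :
    (hubEdges n).card ≤ 3 * n * Nat.log 2 n + 15 * n := by
  have hlevel : ∀ k, ∑ c ∈ range (n / 2 ^ (k + 1) + 1), ∑ t ∈ range (k + 1),
      ((window (2 ^ k * (2 * c + 1)) t (k - t)).image fun x =>
        s(2 ^ k * (2 * c + 1) + t, x)).card ≤ 3 * n + 6 * 2 ^ k := by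
    intro k
    calc _ ≤ ∑ c ∈ range (n / 2 ^ (k + 1) + 1), 6 * 2 ^ k := by
          refine sum_le_sum fun c _ => le_trans (sum_le_sum fun t _ => ?_)
            (sum_two_pow_sub_le k)
          exact card_image_le.trans (card_window_le _ _ _)
      _ = 3 * (n / 2 ^ (k + 1) * 2 ^ (k + 1)) + 6 * 2 ^ k := by
          rw [sum_const, card_range, smul_eq_mul]
          ring
      _ ≤ _ := by
          have := Nat.div_mul_le_self n (2 ^ (k + 1))
          omega
  calc (hubEdges n).card
      ≤ ∑ k ∈ range (Nat.log 2 n + 1), (3 * n + 6 * 2 ^ k) := by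
        refine card_biUnion_le.trans (sum_le_sum fun k _ => le_trans ?_ (hlevel k))
        exact card_biUnion_le.trans (sum_le_sum fun c _ => card_biUnion_le)
    _ ≤ 3 * n * (Nat.log 2 n + 1) + 6 * 2 ^ (Nat.log 2 n + 1) := sum_three_mul_add_le _ _
    _ ≤ _ := by
        have := Nat.pow_log_le_self 2 (x := n) (by omega)
        rw [pow_succ, mul_add, mul_one]
        omega

lemma ncard_edgeSet_hubGraphFin_le (n : ℕ) :
    (hubGraphFin n).edgeSet.ncard ≤ (hubEdges n).card := by
  have hinj : Function.Injective fun i : Fin n => (i : ℕ) + 1 := fun i j h =>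
    Fin.ext (Nat.succ_injective h)
  rw [← Set.ncard_image_of_injective _ (Sym2.map.injective hinj), ← Set.ncard_coe_finset]
  refine Set.ncard_le_ncard ?_ (finite_toSet _)
  rintro _ ⟨e, he, rfl⟩
  induction e with
  | h u v =>
    have hu := u.isLt
    have hv := v.isLt
    rw [SimpleGraph.mem_edgeSet, hubGraphFin, SimpleGraph.comap_adj, hubGraph,
      SimpleGraph.fromRel_adj] at he
    rw [Sym2.map_mk, mem_coe]
    rcases he.2 with ⟨c, t, j, hu', hx⟩ | ⟨c, t, j, hv', hx⟩
    · rw [hu']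
      exact mem_hubEdges (by omega) hx
    · rw [Sym2.eq_swap, hv']
      exact mem_hubEdges (by omega) hx

end UniversalTree

/-- There is a constant `C` such that for every `n ≥ 1` there is an `n`-vertex graph with at
most `(7/2)·n·log₂ n + C·n` edges containing every tree on `n` vertices. -/
theorem statement4 :
    ∃ C : ℝ, ∀ n : ℕ, 1 ≤ n →
      ∃ G : SimpleGraph (Fin n),
        (G.edgeSet.ncard : ℝ) ≤ (7 / 2) * n * Real.logb 2 n + C * n ∧
        ∀ T : SimpleGraph (Fin n), T.IsTree → Contains G T := by
  refine ⟨15, fun n hn => ⟨UniversalTree.hubGraphFin n, ?_,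
    fun T hT => UniversalTree.contains_hubGraphFin hT.isAcyclic⟩⟩
  have h1 : ((UniversalTree.hubGraphFin n).edgeSet.ncard : ℝ) ≤ 3 * n * Nat.log 2 n + 15 * n := by
    exact_mod_cast (UniversalTree.ncard_edgeSet_hubGraphFin_le n).trans
      (UniversalTree.card_hubEdges_le hn)
  have h2 : (Nat.log 2 n : ℝ) ≤ Real.logb 2 n := by
    exact_mod_cast Real.natLog_le_logb n 2
  have h3 : (0 : ℝ) ≤ Nat.log 2 n := Nat.cast_nonneg _
  have h4 : (0 : ℝ) ≤ n := Nat.cast_nonneg _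
  nlinarith [mul_le_mul_of_nonneg_left h2 h4, mul_nonneg h4 (h3.trans h2)]
end
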